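/- arXiv:2601.04125 — 2 statements merged into one kernel-verified Lean document; each statement's English description precedes it below -/
import Mathlib

section
/- Let F be a field with at least 3 elements, n = 4 and k = 2. Then for every degenerate 2-dimensional subspace X of F^4, the set 𝔗_X = {T^c(Y) : Y a non-degenerate 3-dimensional subspace of F^4 with X ⊆ Y} is a maximal clique of the graph Δ'_t. -/
open Module

section Defs

variable (F : Type*) [Field F]

/-- The `i`-th coordinate hyperplane in `F^n`: the kernel of the `i`-th coordinate functional. -/
def coordHyp (n : ℕ) (i : Fin n) : Submodule F (Fin n → F) :=
  LinearMap.ker (LinearMap.proj (R := F) (φ := fun _ : Fin n => F) i)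

/-- A subspace of `F^n` is degenerate if it is contained in some coordinate hyperplane. -/
def IsDeg (n : ℕ) (W : Submodule F (Fin n → F)) : Prop :=
  ∃ i : Fin n, W ≤ coordHyp F n i

/-- A subspace of `F^n` is non-degenerate if it is not degenerate. -/
def IsNondeg (n : ℕ) (W : Submodule F (Fin n → F)) : Prop :=
  ¬ IsDeg F n W

/-- Adjacency of `k`-dimensional subspaces: distinct with `(k-1)`-dimensional intersection. -/
def AdjK (n k : ℕ) (A B : Submodule F (Fin n → F)) : Prop :=
  A ≠ B ∧ finrank F ↥(A ⊓ B) = k - 1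

/-- The star `S(X)`: all `k`-dimensional subspaces containing `X`. -/
def Sstar (n k : ℕ) (X : Submodule F (Fin n → F)) : Set (Submodule F (Fin n → F)) :=
  {A | finrank F ↥A = k ∧ X ≤ A}

/-- `S^c(X)`: all non-degenerate `k`-dimensional subspaces containing `X`. -/
def Sc (n k : ℕ) (X : Submodule F (Fin n → F)) : Set (Submodule F (Fin n → F)) :=
  {A | finrank F ↥A = k ∧ X ≤ A ∧ IsNondeg F n A}

/-- `T^c(Y)`: all non-degenerate `k`-dimensional subspaces contained in `Y`. -/
def Tc (n k : ℕ) (Y : Submodule F (Fin n → F)) : Set (Submodule F (Fin n → F)) :=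
  {A | finrank F ↥A = k ∧ A ≤ Y ∧ IsNondeg F n A}

/-- A clique of `Δ_k(V)`: a set of non-degenerate `k`-dimensional subspaces which are
pairwise adjacent. -/
def IsCliqueD (n k : ℕ) (C : Set (Submodule F (Fin n → F))) : Prop :=
  (∀ A ∈ C, finrank F ↥A = k ∧ IsNondeg F n A) ∧
    ∀ A ∈ C, ∀ B ∈ C, A ≠ B → AdjK F n k A B

/-- A maximal clique of `Δ_k(V)`. -/
def IsMaxCliqueD (n k : ℕ) (C : Set (Submodule F (Fin n → F))) : Prop :=
  IsCliqueD F n k C ∧ ∀ D, IsCliqueD F n k D → C ⊆ D → D = C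

/-- A star of `Δ_k(V)`: a set `S^c(X)` which is a maximal clique of `Δ_k(V)`. -/
def IsStarD (n k : ℕ) (S : Set (Submodule F (Fin n → F))) : Prop :=
  (∃ X : Submodule F (Fin n → F), finrank F ↥X = k - 1 ∧ S = Sc F n k X) ∧
    IsMaxCliqueD F n k S

/-- A top of `Δ_k(V)`: a set `T^c(Y)` which is a maximal clique of `Δ_k(V)`. -/
def IsTopD (n k : ℕ) (T : Set (Submodule F (Fin n → F))) : Prop :=
  (∃ Y : Submodule F (Fin n → F), finrank F ↥Y = k + 1 ∧ T = Tc F n k Y) ∧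
    IsMaxCliqueD F n k T

/-- Adjacency of maximal cliques used in the graphs `Δ_s` and `Δ_t`:
two distinct cliques such that every vertex of each is adjacent to some vertex of the other. -/
def AdjMC (n k : ℕ) (C1 C2 : Set (Submodule F (Fin n → F))) : Prop :=
  C1 ≠ C2 ∧ (∀ A ∈ C1, ∃ B ∈ C2, AdjK F n k A B) ∧
    (∀ A ∈ C2, ∃ B ∈ C1, AdjK F n k A B)

/-- Adjacency in the graphs `Δ'_s` and `Δ'_t`: adjacent as above with empty intersection. -/
def AdjMC' (n k : ℕ) (C1 C2 : Set (Submodule F (Fin n → F))) : Prop :=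
  AdjMC F n k C1 C2 ∧ C1 ∩ C2 = ∅

/-- A clique of the graph `Δ_s` (whose vertices are the stars of `Δ_k(V)`). -/
def IsCliqueDs (n k : ℕ) (𝔖 : Set (Set (Submodule F (Fin n → F)))) : Prop :=
  (∀ S ∈ 𝔖, IsStarD F n k S) ∧ ∀ S ∈ 𝔖, ∀ S' ∈ 𝔖, S ≠ S' → AdjMC F n k S S'

/-- A maximal clique of `Δ_s`. -/
def IsMaxCliqueDs (n k : ℕ) (𝔖 : Set (Set (Submodule F (Fin n → F)))) : Prop :=
  IsCliqueDs F n k 𝔖 ∧ ∀ 𝔖', IsCliqueDs F n k 𝔖' → 𝔖 ⊆ 𝔖' → 𝔖' = 𝔖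

/-- A clique of the graph `Δ'_s`. -/
def IsCliqueDs' (n k : ℕ) (𝔖 : Set (Set (Submodule F (Fin n → F)))) : Prop :=
  (∀ S ∈ 𝔖, IsStarD F n k S) ∧ ∀ S ∈ 𝔖, ∀ S' ∈ 𝔖, S ≠ S' → AdjMC' F n k S S'

/-- A maximal clique of `Δ'_s`. -/
def IsMaxCliqueDs' (n k : ℕ) (𝔖 : Set (Set (Submodule F (Fin n → F)))) : Prop :=
  IsCliqueDs' F n k 𝔖 ∧ ∀ 𝔖', IsCliqueDs' F n k 𝔖' → 𝔖 ⊆ 𝔖' → 𝔖' = 𝔖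

/-- A special set of stars: a maximal clique in both `Δ_s` and `Δ'_s`. -/
def IsSpecialStars (n k : ℕ) (𝔖 : Set (Set (Submodule F (Fin n → F)))) : Prop :=
  IsMaxCliqueDs F n k 𝔖 ∧ IsMaxCliqueDs' F n k 𝔖

/-- A clique of the graph `Δ_t` (whose vertices are the tops of `Δ_k(V)`). -/
def IsCliqueDt (n k : ℕ) (𝔗 : Set (Set (Submodule F (Fin n → F)))) : Prop :=
  (∀ T ∈ 𝔗, IsTopD F n k T) ∧ ∀ T ∈ 𝔗, ∀ T' ∈ 𝔗, T ≠ T' → AdjMC F n k T T'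

/-- A maximal clique of `Δ_t`. -/
def IsMaxCliqueDt (n k : ℕ) (𝔗 : Set (Set (Submodule F (Fin n → F)))) : Prop :=
  IsCliqueDt F n k 𝔗 ∧ ∀ 𝔗', IsCliqueDt F n k 𝔗' → 𝔗 ⊆ 𝔗' → 𝔗' = 𝔗

/-- A clique of the graph `Δ'_t`. -/
def IsCliqueDt' (n k : ℕ) (𝔗 : Set (Set (Submodule F (Fin n → F)))) : Prop :=
  (∀ T ∈ 𝔗, IsTopD F n k T) ∧ ∀ T ∈ 𝔗, ∀ T' ∈ 𝔗, T ≠ T' → AdjMC' F n k T T'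

/-- A maximal clique of `Δ'_t`. -/
def IsMaxCliqueDt' (n k : ℕ) (𝔗 : Set (Set (Submodule F (Fin n → F)))) : Prop :=
  IsCliqueDt' F n k 𝔗 ∧ ∀ 𝔗', IsCliqueDt' F n k 𝔗' → 𝔗 ⊆ 𝔗' → 𝔗' = 𝔗

/-- A special set of tops: a maximal clique in both `Δ_t` and `Δ'_t`. -/
def IsSpecialTops (n k : ℕ) (𝔗 : Set (Set (Submodule F (Fin n → F)))) : Prop :=
  IsMaxCliqueDt F n k 𝔗 ∧ IsMaxCliqueDt' F n k 𝔗

/-- `𝔗_X`: the set of all `T^c(Y)` over non-degenerate `(k+1)`-dimensional `Y` containing `X`. -/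
def TopsThrough (n k : ℕ) (X : Submodule F (Fin n → F)) :
    Set (Set (Submodule F (Fin n → F))) :=
  {T | ∃ Y : Submodule F (Fin n → F),
    finrank F ↥Y = k + 1 ∧ IsNondeg F n Y ∧ X ≤ Y ∧ T = Tc F n k Y}

end Defs

/-- Over a field with at least three elements, a subspace which is contained in none of three given
subspaces is not covered by their union. -/
theorem Submodule.exists_mem_notMem_three {F M : Type*} [Field F] [AddCommGroup M] [Module F M]
    (hF : (3 : Cardinal) ≤ Cardinal.mk F) {Y H₁ H₂ H₃ : Submodule F M}
    (h₁ : ¬ Y ≤ H₁) (h₂ : ¬ Y ≤ H₂) (h₃ : ¬ Y ≤ H₃) :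
    ∃ y ∈ Y, y ∉ H₁ ∧ y ∉ H₂ ∧ y ∉ H₃ := by
  have line : ∀ {H : Submodule F M} {u w : M} {s t : F}, w ∉ H → u + s • w ∈ H →
      u + t • w ∈ H → s = t := by
    intro H u w s t hw hs ht
    by_contra hst
    apply hw
    have hsub := H.sub_mem hs ht
    rw [add_sub_add_left_eq_sub, ← sub_smul] at hsub
    exact (H.smul_mem_iff (sub_ne_zero.mpr hst)).mp hsub
  obtain ⟨w, hwY, hw₁, hw₂⟩ : ∃ w ∈ Y, w ∉ H₁ ∧ w ∉ H₂ := by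
    obtain ⟨a, haY, ha⟩ := SetLike.not_le_iff_exists.mp h₁
    obtain ⟨b, hbY, hb⟩ := SetLike.not_le_iff_exists.mp h₂
    by_cases ha₂ : a ∈ H₂
    · by_cases hb₁ : b ∈ H₁
      · exact ⟨a + b, Y.add_mem haY hbY, fun h => ha ((H₁.add_mem_iff_left hb₁).mp h),
          fun h => hb ((H₂.add_mem_iff_right ha₂).mp h)⟩
      · exact ⟨b, hbY, hb₁, hb⟩
    · exact ⟨a, haY, ha, ha₂⟩
  by_cases hw₃ : w ∈ H₃
  · obtain ⟨u, huY, hu⟩ := SetLike.not_le_iff_exists.mp h₃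
    obtain ⟨f⟩ : Nonempty (Fin 3 ↪ F) := by
      rw [← Cardinal.lift_mk_le']
      simpa using hF
    have hmem : ∀ t : F, u + t • w ∈ Y := fun t => Y.add_mem huY (Y.smul_mem t hwY)
    have hnot : ∀ t : F, u + t • w ∉ H₃ := fun t h =>
      hu ((H₃.add_mem_iff_left (H₃.smul_mem t hw₃)).mp h)
    by_contra! hcon
    have hor : ∀ t : F, u + t • w ∈ H₁ ∨ u + t • w ∈ H₂ := fun t => by
      by_contra! h
      exact hnot t (hcon _ (hmem t) h.1 h.2)
    have h01 : f 0 ≠ f 1 := f.injective.ne (by decide)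
    have h02 : f 0 ≠ f 2 := f.injective.ne (by decide)
    have h12 : f 1 ≠ f 2 := f.injective.ne (by decide)
    rcases hor (f 0) with a | a <;> rcases hor (f 1) with b | b <;> rcases hor (f 2) with c | c <;>
      first
        | exact h01 (line hw₁ a b)
        | exact h01 (line hw₂ a b)
        | exact h02 (line hw₁ a c)
        | exact h02 (line hw₂ a c)
        | exact h12 (line hw₁ b c)
        | exact h12 (line hw₂ b c)
  · exact ⟨w, hwY, hw₁, hw₂, hw₃⟩

theorem finrank_span_pair_eq_two {F M : Type*} [Field F] [AddCommGroup M] [Module F M]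
    {v w : M} (hv : v ≠ 0) (hw : w ∉ Submodule.span F {v}) :
    finrank F ↥(Submodule.span F {v, w}) = 2 := by
  have hli : LinearIndependent F ![v, w] := by
    rw [LinearIndependent.pair_iff' hv]
    intro a ha
    exact hw (Submodule.mem_span_singleton.mpr ⟨a, ha⟩)
  have h := finrank_span_eq_card hli
  rwa [Matrix.range_cons_cons_empty, Fintype.card_fin] at h

section Planes

variable {F : Type*} [Field F]

theorem mem_coordHyp {n : ℕ} {i : Fin n} {x : Fin n → F} : x ∈ coordHyp F n i ↔ x i = 0 :=
  Iff.rfl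

theorem IsNondeg.mono {n : ℕ} {A B : Submodule F (Fin n → F)} (hA : IsNondeg F n A)
    (h : A ≤ B) : IsNondeg F n B :=
  fun ⟨i, hi⟩ => hA ⟨i, h.trans hi⟩

theorem IsNondeg.not_le {n : ℕ} {A : Submodule F (Fin n → F)} (hA : IsNondeg F n A) (i : Fin n) :
    ¬ A ≤ coordHyp F n i :=
  fun h => hA ⟨i, h⟩

theorem isNondeg_span_pair {n : ℕ} {v w : Fin n → F} (h : ∀ i, v i ≠ 0 ∨ w i ≠ 0) :
    IsNondeg F n (Submodule.span F {v, w}) := by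
  rintro ⟨i, hi⟩
  rw [Submodule.span_le, Set.insert_subset_iff, Set.singleton_subset_iff] at hi
  exact (h i).elim (fun hv => hv hi.1) (fun hw => hw hi.2)

theorem not_le_of_finrank_lt {M : Type*} [AddCommGroup M] [Module F M] {A B : Submodule F M}
    [FiniteDimensional F B] (h : finrank F ↥B < finrank F ↥A) : ¬ A ≤ B :=
  fun hle => (Submodule.finrank_mono hle).not_gt h

/-- A line of a non-degenerate hyperplane of `F^4` lies on a non-degenerate plane inside it. -/
theorem exists_mem_Tc_of_mem (hF : (3 : Cardinal) ≤ Cardinal.mk F) {Y : Submodule F (Fin 4 → F)}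
    (hY : finrank F ↥Y = 3) (hYn : IsNondeg F 4 Y) {p : Fin 4 → F} (hpY : p ∈ Y) (hp : p ≠ 0) :
    ∃ B ∈ Tc F 4 2 Y, p ∈ B := by
  suffices ∃ w ∈ Y, w ∉ Submodule.span F {p} ∧ ∀ i, p i ≠ 0 ∨ w i ≠ 0 by
    obtain ⟨w, hwY, hw, hc⟩ := this
    refine ⟨Submodule.span F {p, w}, ⟨finrank_span_pair_eq_two hp hw, ?_, isNondeg_span_pair hc⟩,
      Submodule.mem_span_of_mem (by simp)⟩
    rw [Submodule.span_le, Set.insert_subset_iff, Set.singleton_subset_iff]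
    exact ⟨hpY, hwY⟩
  by_cases hall : ∀ i, p i ≠ 0
  · have : ¬ Y ≤ Submodule.span F {p} := not_le_of_finrank_lt (by
      rw [finrank_span_singleton hp, hY]; norm_num)
    obtain ⟨w, hwY, hw⟩ := SetLike.not_le_iff_exists.mp this
    exact ⟨w, hwY, hw, fun i => Or.inl (hall i)⟩
  · push Not at hall
    obtain ⟨m, hm⟩ := hall
    obtain ⟨i, hi⟩ := Function.ne_iff.mp hp
    obtain ⟨a, b, c, habc⟩ : ∃ a b c : Fin 4, ∀ j, j ≠ i → j = a ∨ j = b ∨ j = c := by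
      clear hi
      decide +revert
    obtain ⟨w, hwY, ha, hb, hc⟩ := Submodule.exists_mem_notMem_three hF
      (hYn.not_le a) (hYn.not_le b) (hYn.not_le c)
    have hne : ∀ j, j ≠ i → w j ≠ 0 := by
      intro j hj
      rcases habc j hj with rfl | rfl | rfl <;> assumption
    refine ⟨w, hwY, fun h => ?_, fun j => ?_⟩
    · obtain ⟨t, rfl⟩ := Submodule.mem_span_singleton.mp h
      refine hne m (fun h => hi (h ▸ hm)) ?_
      simp [hm]
    · by_cases hj : j = i
      · exact Or.inl (hj ▸ hi)
      · exact Or.inr (hne j hj)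

/-- The non-degenerate planes inside a non-degenerate hyperplane of `F^4` have no nonzero vector in
common. -/
theorem exists_mem_Tc_of_notMem (hF : (3 : Cardinal) ≤ Cardinal.mk F)
    {Y : Submodule F (Fin 4 → F)} (hY : finrank F ↥Y = 3) (hYn : IsNondeg F 4 Y)
    {p : Fin 4 → F} (hp : p ≠ 0) :
    ∃ B ∈ Tc F 4 2 Y, p ∉ B := by
  obtain ⟨i, hi⟩ := Function.ne_iff.mp hp
  have hker : ∀ j, 3 ≤ finrank F ↥(coordHyp F 4 j) := by
    intro j
    let f : (Fin 4 → F) →ₗ[F] F := LinearMap.proj j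
    have h : finrank F ↥(LinearMap.range f) + finrank F ↥(coordHyp F 4 j) = finrank F (Fin 4 → F) :=
      LinearMap.finrank_range_add_finrank_ker f
    have h1 : finrank F ↥(LinearMap.range f) ≤ 1 := (Submodule.finrank_le _).trans (by simp)
    rw [finrank_fin_fun] at h
    omega
  have hinf : ∀ (W : Submodule F (Fin 4 → F)) (j : Fin 4),
      finrank F ↥W ≤ finrank F ↥(W ⊓ coordHyp F 4 j) + 1 := by
    intro W j
    have h := Submodule.finrank_sup_add_finrank_inf_eq W (coordHyp F 4 j)
    have h4 : finrank F ↥(W ⊔ coordHyp F 4 j) ≤ 4 :=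
      (Submodule.finrank_le _).trans (by simp)
    have := hker j
    omega
  have hnz : ∀ W : Submodule F (Fin 4 → F), 1 ≤ finrank F ↥W → ∃ v ∈ W, ∃ j, v j ≠ 0 := by
    intro W hW
    have hW0 : W ≠ ⊥ := by rintro rfl; simp at hW
    obtain ⟨v, hv, hv0⟩ := W.ne_bot_iff.mp hW0
    exact ⟨v, hv, Function.ne_iff.mp hv0⟩
  have hW := hinf Y i
  set W := Y ⊓ coordHyp F 4 i
  obtain ⟨v₁, hv₁, j, hj⟩ := hnz W (by omega)
  have hWj := hinf W j
  obtain ⟨v₂, hv₂, k, hk⟩ := hnz (W ⊓ coordHyp F 4 j) (by omega)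
  have hij : i ≠ j := by rintro rfl; exact hj hv₁.2
  have hik : i ≠ k := by rintro rfl; exact hk hv₂.1.2
  have hjk : j ≠ k := by rintro rfl; exact hk hv₂.2
  have hWnj : ¬ W ≤ coordHyp F 4 j := fun h => hj (h hv₁)
  have hWnk : ¬ W ≤ coordHyp F 4 k := fun h => hk (h hv₂.1)
  obtain ⟨v, hvW, hvj, hvk, -⟩ := Submodule.exists_mem_notMem_three hF hWnj hWnk hWnk
  obtain ⟨hvY, hvi⟩ := hvW
  rw [SetLike.mem_coe, mem_coordHyp] at hvi
  rw [mem_coordHyp] at hvj hvk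
  have hv0 : v ≠ 0 := fun h => hvj (by rw [h]; rfl)
  have hpv : p ∉ Submodule.span F {v} := by
    intro h
    obtain ⟨t, rfl⟩ := Submodule.mem_span_singleton.mp h
    exact hi (by simp [hvi])
  obtain ⟨l, hl⟩ : ∃ l : Fin 4, ∀ m, m = i ∨ m = j ∨ m = k ∨ m = l := by
    clear * - hij hik hjk
    decide +revert
  have hYs : ¬ Y ≤ Submodule.span F {v, p} := not_le_of_finrank_lt (by
    rw [finrank_span_pair_eq_two hv0 hpv, hY]; norm_num)
  obtain ⟨w, hwY, hwi, hwl, hws⟩ := Submodule.exists_mem_notMem_three hF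
    (hYn.not_le i) (hYn.not_le l) hYs
  have hwv : w ∉ Submodule.span F {v} := fun h => hws (Submodule.span_mono (by simp) h)
  refine ⟨Submodule.span F {v, w}, ⟨finrank_span_pair_eq_two hv0 hwv, ?_,
    isNondeg_span_pair fun m => ?_⟩, fun h => ?_⟩
  · rw [Submodule.span_le, Set.insert_subset_iff, Set.singleton_subset_iff]
    exact ⟨hvY, hwY⟩
  · rcases hl m with rfl | rfl | rfl | rfl
    · exact Or.inr hwi
    · exact Or.inl hvj
    · exact Or.inl hvk
    · exact Or.inr hwl
  · rw [Set.pair_comm] at h hws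
    exact hws (mem_span_insert_exchange h hpv)

theorem finrank_inf_eq_one_of_not_le {Y A : Submodule F (Fin 4 → F)} (hY : finrank F ↥Y = 3)
    (hA : finrank F ↥A = 2) (h : ¬ A ≤ Y) : finrank F ↥(A ⊓ Y) = 1 := by
  have hs := Submodule.finrank_sup_add_finrank_inf_eq A Y
  have h4 : finrank F ↥(A ⊔ Y) ≤ 4 := (Submodule.finrank_le _).trans (by simp)
  have hlt := Submodule.finrank_lt_finrank_of_lt (right_lt_sup.mpr h)
  omega

theorem not_le_of_ne_of_finrank_eq {M : Type*} [AddCommGroup M] [Module F M]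
    {A B : Submodule F M} [FiniteDimensional F B] (hne : A ≠ B)
    (h : finrank F ↥A = finrank F ↥B) : ¬ A ≤ B :=
  fun hle => hne (Submodule.eq_of_le_of_finrank_eq hle h)

theorem isMaxCliqueD_Tc (hF : (3 : Cardinal) ≤ Cardinal.mk F) {Y : Submodule F (Fin 4 → F)}
    (hY : finrank F ↥Y = 3) (hYn : IsNondeg F 4 Y) : IsMaxCliqueD F 4 2 (Tc F 4 2 Y) := by
  refine ⟨⟨fun A hA => ⟨hA.1, hA.2.2⟩, ?_⟩, ?_⟩
  · rintro A ⟨hA, hAY, -⟩ B ⟨hB, hBY, -⟩ hne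
    refine ⟨hne, ?_⟩
    have hs := Submodule.finrank_sup_add_finrank_inf_eq A B
    have h3 := Submodule.finrank_mono (sup_le hAY hBY)
    have hlt := Submodule.finrank_lt_finrank_of_lt
      (right_lt_sup.mpr (not_le_of_ne_of_finrank_eq hne (hA.trans hB.symm)))
    omega
  · rintro D ⟨hDv, hD⟩ hsub
    refine Set.Subset.antisymm (fun Z hZ => ?_) hsub
    obtain ⟨hZ2, hZn⟩ := hDv Z hZ
    refine ⟨hZ2, ?_, hZn⟩
    by_contra hZY
    have h1 := finrank_inf_eq_one_of_not_le hY hZ2 hZY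
    have h0 : Z ⊓ Y ≠ ⊥ := by intro h; rw [h] at h1; simp at h1
    obtain ⟨p, hpZY, hp⟩ := (Z ⊓ Y).ne_bot_iff.mp h0
    obtain ⟨B, hB, hpB⟩ := exists_mem_Tc_of_notMem hF hY hYn hp
    have hZB : Z ≠ B := by rintro rfl; exact hZY hB.2.1
    have hadj : finrank F ↥(Z ⊓ B) = 1 := (hD Z hZ B (hsub hB) hZB).2
    have heq := Submodule.eq_of_le_of_finrank_eq (inf_le_inf_left Z hB.2.1) (hadj.trans h1.symm)
    rw [← heq] at hpZY
    exact hpB hpZY.2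

theorem isNondeg_of_isMaxCliqueD_Tc {Y : Submodule F (Fin 4 → F)}
    (h : IsMaxCliqueD F 4 2 (Tc F 4 2 Y)) : IsNondeg F 4 Y := by
  intro hdeg
  have hempty : Tc F 4 2 Y = ∅ :=
    Set.eq_empty_of_forall_notMem fun A hA => hA.2.2.mono hA.2.1 hdeg
  let a : Fin 4 → F := ![1, 1, 0, 0]
  let b : Fin 4 → F := ![0, 0, 1, 1]
  have ha : a ≠ 0 := fun h => one_ne_zero (congrFun h 0 : (1 : F) = 0)
  have hb : b ∉ Submodule.span F {a} := by
    intro h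
    obtain ⟨t, ht⟩ := Submodule.mem_span_singleton.mp h
    have := congrFun ht 2
    simp [a, b] at this
  have hn : IsNondeg F 4 (Submodule.span F {a, b}) :=
    isNondeg_span_pair fun i => by fin_cases i <;> simp [a, b]
  have hC : IsCliqueD F 4 2 {Submodule.span F {a, b}} := by
    refine ⟨?_, ?_⟩
    · rintro A rfl
      exact ⟨finrank_span_pair_eq_two ha hb, hn⟩
    · rintro A rfl B rfl hne
      exact absurd rfl hne
  have := h.2 _ hC (by simp [hempty])
  rw [hempty] at this
  exact Set.singleton_ne_empty _ this

theorem exists_adjK_of_mem_Tc (hF : (3 : Cardinal) ≤ Cardinal.mk F)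
    {Y A : Submodule F (Fin 4 → F)} (hY : finrank F ↥Y = 3) (hYn : IsNondeg F 4 Y)
    (hA : finrank F ↥A = 2) (hAY : ¬ A ≤ Y) : ∃ B ∈ Tc F 4 2 Y, AdjK F 4 2 A B := by
  have h1 := finrank_inf_eq_one_of_not_le hY hA hAY
  have h0 : A ⊓ Y ≠ ⊥ := by intro h; rw [h] at h1; simp at h1
  obtain ⟨p, hpAY, hp⟩ := (A ⊓ Y).ne_bot_iff.mp h0
  obtain ⟨B, hB, hpB⟩ := exists_mem_Tc_of_mem hF hY hYn hpAY.2 hp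
  refine ⟨B, hB, fun h => hAY (h ▸ hB.2.1), ?_⟩
  have hle := Submodule.finrank_mono (inf_le_inf_left A hB.2.1)
  have hge : finrank F ↥(A ⊓ B) ≠ 0 := by
    intro h
    rw [Submodule.finrank_eq_zero] at h
    exact hp ((Submodule.mem_bot F).mp (h ▸ ⟨hpAY.1, hpB⟩))
  omega

theorem inf_eq_of_le_of_ne {X Y₁ Y₂ : Submodule F (Fin 4 → F)} (hX : finrank F ↥X = 2)
    (h₁ : finrank F ↥Y₁ = 3) (h₂ : finrank F ↥Y₂ = 3) (hne : Y₁ ≠ Y₂)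
    (hX₁ : X ≤ Y₁) (hX₂ : X ≤ Y₂) : Y₁ ⊓ Y₂ = X := by
  have hlt : Y₁ ⊓ Y₂ < Y₁ :=
    inf_lt_left.mpr (not_le_of_ne_of_finrank_eq hne (h₁.trans h₂.symm))
  have := Submodule.finrank_lt_finrank_of_lt hlt
  exact (Submodule.eq_of_le_of_finrank_le (le_inf hX₁ hX₂) (by omega)).symm

end Planes

/-- for `|F| ≥ 3`, `n = 4`, `k = 2`, the set
`𝔗_X = {T^c(Y) : Y non-degenerate 3-dimensional, X ⊆ Y}` is a maximal clique of `Δ'_t`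
for every degenerate `2`-dimensional subspace `X`. -/
theorem stmt14 (F : Type*) [Field F] (hF : (3 : Cardinal) ≤ Cardinal.mk F)
    (X : Submodule F (Fin 4 → F)) (hXrk : finrank F ↥X = 2) (hXd : IsDeg F 4 X) :
    IsMaxCliqueDt' F 4 2 (TopsThrough F 4 2 X) := by
  refine ⟨⟨?_, ?_⟩, ?_⟩
  · rintro T ⟨Y, hY, hYn, -, rfl⟩
    exact ⟨⟨Y, hY, rfl⟩, isMaxCliqueD_Tc hF hY hYn⟩
  · rintro T ⟨Y₁, h₁, hn₁, hX₁, rfl⟩ T' ⟨Y₂, h₂, hn₂, hX₂, rfl⟩ hne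
    have hinf := inf_eq_of_le_of_ne hXrk h₁ h₂ (fun h => hne (h ▸ rfl)) hX₁ hX₂
    have hout : ∀ A, IsNondeg F 4 A → ¬ (A ≤ Y₁ ∧ A ≤ Y₂) := fun A hA h =>
      hA.mono (hinf ▸ le_inf h.1 h.2) hXd
    refine ⟨⟨hne, fun A hA => ?_, fun A hA => ?_⟩, ?_⟩
    · exact exists_adjK_of_mem_Tc hF h₂ hn₂ hA.1 fun h => hout A hA.2.2 ⟨hA.2.1, h⟩
    · exact exists_adjK_of_mem_Tc hF h₁ hn₁ hA.1 fun h => hout A hA.2.2 ⟨h, hA.2.1⟩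
    · exact Set.eq_empty_of_forall_notMem fun A hA => hout A hA.1.2.2 ⟨hA.1.2.1, hA.2.2.1⟩
  · rintro 𝔗 ⟨htop, hadj⟩ hsub
    refine Set.Subset.antisymm (fun T hT => ?_) hsub
    by_contra hTX
    obtain ⟨⟨Y, hY, rfl⟩, hmax⟩ := htop T hT
    have hYn := isNondeg_of_isMaxCliqueD_Tc hmax
    have hXY : ¬ X ≤ Y := fun h => hTX ⟨Y, hY, hYn, h, rfl⟩
    have h1 := finrank_inf_eq_one_of_not_le hY hXrk hXY
    obtain ⟨B, hB, hXB⟩ := exists_adjK_of_mem_Tc hF hY hYn hXrk hXY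
    have hmem : Tc F 4 2 (X ⊔ B) ∈ TopsThrough F 4 2 X := by
      refine ⟨X ⊔ B, ?_, hB.2.2.mono le_sup_right, le_sup_left, rfl⟩
      have hs := Submodule.finrank_sup_add_finrank_inf_eq X B
      have := hXB.2
      have := hB.1
      omega
    have hdisj := (hadj _ hT _ (hsub hmem) fun h => hTX (h ▸ hmem)).2
    exact (hdisj ▸ (⟨hB, hB.1, le_sup_right, hB.2.2⟩ :
      B ∈ Tc F 4 2 Y ∩ Tc F 4 2 (X ⊔ B)) : B ∈ (∅ : Set _))
end

section
/- Let F = F_q be the finite field with q elements, and let n, k satisfy 1 < k < n−1 and q = n−k. Then there exist a non-degenerate (k+1)-dimensional subspace Y of F^n and a (k−1)-dimensional subspace X of F^n with X ⊆ Y such that every k-dimensional subspace A of F^n with X ⊆ A ⊆ Y is degenerate. -/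
open Module

/-- The linear map `(x, (a, b)) ↦ (x, a, (b + t * a)_t)`: the last `q + 1` coordinates represent
all linear functionals on `F × F` up to scaling. -/
def projLineEmb (F : Type*) [Field F] {ι κ : Type*} (e : ι ≃ κ ⊕ Option F) :
    ((κ → F) × (F × F)) →ₗ[F] (ι → F) where
  toFun p i := Sum.elim p.1 (fun o => o.elim p.2.1 (fun t => p.2.2 + t * p.2.1)) (e i)
  map_add' p p' := by
    ext i
    rcases h : e i with j | _ | t <;> simp [h]
    ring
  map_smul' c p := by
    ext i
    rcases h : e i with j | _ | t <;> simp [h]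
    ring

section projLineEmb

variable {F : Type*} [Field F] {ι κ : Type*} (e : ι ≃ κ ⊕ Option F)

@[simp] lemma projLineEmb_inl (p : (κ → F) × (F × F)) (j : κ) :
    projLineEmb F e p (e.symm (Sum.inl j)) = p.1 j := by
  simp [projLineEmb]

@[simp] lemma projLineEmb_none (p : (κ → F) × (F × F)) :
    projLineEmb F e p (e.symm (Sum.inr none)) = p.2.1 := by
  simp [projLineEmb]

@[simp] lemma projLineEmb_some (p : (κ → F) × (F × F)) (t : F) :
    projLineEmb F e p (e.symm (Sum.inr (some t))) = p.2.2 + t * p.2.1 := by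
  simp [projLineEmb]

lemma projLineEmb_injective : Function.Injective (projLineEmb F e) := by
  rw [← LinearMap.ker_eq_bot, LinearMap.ker_eq_bot']
  intro p hp
  have h (i : ι) : projLineEmb F e p i = 0 := by rw [hp]; rfl
  have h1 : p.2.1 = 0 := by simpa using h (e.symm (Sum.inr none))
  have h2 : p.2.2 = 0 := by simpa using h (e.symm (Sum.inr (some 0)))
  have h3 : p.1 = 0 := funext fun j => by simpa using h (e.symm (Sum.inl j))
  exact Prod.ext h3 (Prod.ext h1 h2)

lemma exists_projLineEmb_ne_zero (i : ι) : ∃ p, projLineEmb F e p i ≠ 0 := by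
  obtain ⟨i, rfl⟩ := e.symm.surjective i
  rcases i with j | _ | t
  · exact ⟨(1, 0), by simp⟩
  · exact ⟨(0, (1, 0)), by simp⟩
  · exact ⟨(0, (0, 1)), by simp⟩

/-- Every vector of `F × F` is annihilated by one of the last `q + 1` coordinates. -/
lemma exists_projLineEmb_eq_zero (v : F × F) : ∃ i, ∀ x, projLineEmb F e (x, v) i = 0 ∧
    projLineEmb F e (x, 0) i = 0 := by
  by_cases ha : v.1 = 0
  · exact ⟨e.symm (Sum.inr none), fun x => by simp [ha]⟩
  · exact ⟨e.symm (Sum.inr (some (-v.2 / v.1))), fun x => by simp [ha]⟩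

end projLineEmb

/-- for `F = F_q` with `q = n - k`, there are a non-degenerate
`(k+1)`-dimensional subspace `Y` and a `(k-1)`-dimensional subspace `X ⊆ Y` such that every
`k`-dimensional subspace between `X` and `Y` is degenerate. -/
theorem stmt18 (F : Type*) [Field F] [Fintype F] (n k q : ℕ)
    (hq : Fintype.card F = q) (hk1 : 1 < k) (hk2 : k < n - 1) (hqnk : q = n - k) :
    ∃ Y X : Submodule F (Fin n → F),
      finrank F ↥Y = k + 1 ∧ IsNondeg F n Y ∧
      finrank F ↥X = k - 1 ∧ X ≤ Y ∧
      ∀ A : Submodule F (Fin n → F), finrank F ↥A = k → X ≤ A → A ≤ Y → IsDeg F n A := by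
  obtain ⟨e⟩ : Nonempty (Fin n ≃ Fin (k - 1) ⊕ Option F) := by
    rw [← Fintype.card_eq]
    simp only [Fintype.card_fin, Fintype.card_sum, Fintype.card_option]
    omega
  have hinj := projLineEmb_injective e
  set φ := projLineEmb F e
  have hX : finrank F (φ ∘ₗ LinearMap.inl F (Fin (k - 1) → F) (F × F)).range = k - 1 := by
    have h : Function.Injective (φ ∘ₗ LinearMap.inl F (Fin (k - 1) → F) (F × F)) :=
      hinj.comp LinearMap.inl_injective
    simp [LinearMap.finrank_range_of_inj h]
  refine ⟨φ.range, (φ ∘ₗ LinearMap.inl F _ _).range, ?_, ?_, hX, LinearMap.range_comp_le_range _ _,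
    ?_⟩
  · rw [LinearMap.finrank_range_of_inj hinj]
    simp only [finrank_prod, finrank_fin_fun, finrank_self]
    omega
  · rintro ⟨i, hi⟩
    obtain ⟨p, hp⟩ := exists_projLineEmb_ne_zero e i
    exact hp (hi ⟨p, rfl⟩)
  · intro A hA hXA hAY
    set X := (φ ∘ₗ LinearMap.inl F (Fin (k - 1) → F) (F × F)).range
    obtain ⟨y, hyA, hyX⟩ : ∃ y ∈ A, y ∉ X := by
      by_contra! h
      rw [le_antisymm h hXA] at hA
      omega
    have hsup : X ⊔ Submodule.span F {y} = A := by
      refine Submodule.eq_of_le_of_finrank_le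
        (sup_le hXA ((Submodule.span_singleton_le_iff_mem _ _).2 hyA)) ?_
      have hlt : X < X ⊔ Submodule.span F {y} :=
        left_lt_sup.2 fun h => hyX ((Submodule.span_singleton_le_iff_mem _ _).1 h)
      have := Submodule.finrank_lt_finrank_of_lt hlt
      omega
    obtain ⟨⟨x, v⟩, rfl⟩ := hAY hyA
    obtain ⟨i, hi⟩ := exists_projLineEmb_eq_zero e v
    refine ⟨i, ?_⟩
    rw [← hsup, sup_le_iff, Submodule.span_singleton_le_iff_mem]
    refine ⟨?_, (hi x).1⟩
    rintro _ ⟨z, rfl⟩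
    exact (hi z).2
end
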